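/- Let Ω ⊆ ℝ^d be bounded, α ∈ (0,1), W = {w_1,…,w_M} ⊂ ℤ finite, F: L^1(Ω) → ℝ bounded below and continuous with respect to L^2-convergence on W-valued functions, η > 0. Then the problem of minimizing J_α(w) = F(w) + η Σ_{i=1}^M |w_i| (1−α) P_α(w^{-1}({w_i})) over measurable w: Ω → W (extended by zero outside Ω) admits a minimizer. -/

import Mathlib

open MeasureTheory Filter
open scoped ENNReal NNReal symmDiff

/-- The fractional perimeter `P_α(E) = 2 ∫_E ∫_{E^c} |x-y|^{-(d+α)} dx dy`,
with values in `[0,∞]`. -/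
noncomputable def fracPer (d : ℕ) (α : ℝ) (E : Set (EuclideanSpace ℝ (Fin d))) : ℝ≥0∞ :=
  2 * ∫⁻ x in E, ∫⁻ y in Eᶜ, ENNReal.ofReal (‖x - y‖ ^ (-((d : ℝ) + α)))


/-- Feasibility: `w` is measurable, vanishes outside `Ω` and takes values in
`W = {w_1, …, w_M}` a.e. on `Ω`. -/
def Feasible (d M : ℕ) (Ω : Set (EuclideanSpace ℝ (Fin d))) (wv : Fin M → ℤ)
    (w : EuclideanSpace ℝ (Fin d) → ℝ) : Prop :=
  Measurable w ∧ (∀ x, x ∉ Ω → w x = 0) ∧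
    ∀ᵐ x ∂(volume.restrict Ω), ∃ i, w x = (wv i : ℝ)

/-- The fractional-perimeter regularizer
`R_α(w) = (1−α) Σ_i |w_i| P_α(w⁻¹({w_i}))`. -/
noncomputable def Reg (d M : ℕ) (α : ℝ) (wv : Fin M → ℤ)
    (w : EuclideanSpace ℝ (Fin d) → ℝ) : ℝ≥0∞ :=
  ∑ i, ((wv i).natAbs : ℝ≥0∞) * ENNReal.ofReal (1 - α) * fracPer d α (w ⁻¹' {(wv i : ℝ)})


lemma fm_meas_kernel (d : ℕ) (α : ℝ) :
    Measurable (fun p : EuclideanSpace ℝ (Fin d) × EuclideanSpace ℝ (Fin d) =>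
      ENNReal.ofReal (‖p.1 - p.2‖ ^ (-((d : ℝ) + α)))) := by
  fun_prop

lemma fm_fracPer_eq (d : ℕ) (α : ℝ) (E : Set (EuclideanSpace ℝ (Fin d))) :
    fracPer d α E = 2 * ∫⁻ p in E ×ˢ Eᶜ, ENNReal.ofReal (‖p.1 - p.2‖ ^ (-((d : ℝ) + α)))
      ∂((volume : Measure (EuclideanSpace ℝ (Fin d))).prod volume) := by
  unfold fracPer
  rw [setLIntegral_prod _ (fm_meas_kernel d α).aemeasurable]

/-- index of the grid cell containing `x`. -/
noncomputable def fmIdx (d N : ℕ) (x : EuclideanSpace ℝ (Fin d)) : Fin d → ℤ :=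
  fun i => ⌊((N : ℝ) + 1) * x i⌋

/-- grid cell. -/
def fmCell (d N : ℕ) (j : Fin d → ℤ) : Set (EuclideanSpace ℝ (Fin d)) :=
  fmIdx d N ⁻¹' {j}

lemma fm_measurable_idx (d N : ℕ) : Measurable (fmIdx d N) := by
  unfold fmIdx
  rw [measurable_pi_iff]
  intro i
  apply Measurable.floor
  fun_prop

lemma fm_measurable_cell (d N : ℕ) (j : Fin d → ℤ) : MeasurableSet (fmCell d N j) :=
  fm_measurable_idx d N (measurableSet_singleton _)

lemma fm_cell_volume (d N : ℕ) (j : Fin d → ℤ) :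
    volume (fmCell d N j) = ENNReal.ofReal ((((N : ℝ) + 1) ^ d)⁻¹) := by
  have hN : (0 : ℝ) < (N : ℝ) + 1 := by positivity
  have h1 : fmCell d N j = (@WithLp.ofLp 2 (Fin d → ℝ)) ⁻¹'
      (Set.univ.pi fun i => Set.Ico ((j i : ℝ) / ((N : ℝ) + 1)) (((j i : ℝ) + 1) / ((N : ℝ) + 1))) := by
    ext x
    simp only [fmCell, fmIdx, Set.mem_preimage, Set.mem_singleton_iff, funext_iff, Set.mem_pi,
      Set.mem_univ, true_imp_iff, Set.mem_Ico, Int.floor_eq_iff]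
    refine forall_congr' fun i => ?_
    rw [div_le_iff₀ hN, lt_div_iff₀ hN, mul_comm]
  rw [h1, (PiLp.volume_preserving_ofLp (Fin d)).measure_preimage
    (MeasurableSet.univ_pi fun i => measurableSet_Ico).nullMeasurableSet, volume_pi, Measure.pi_pi]
  simp only [Real.volume_Ico]
  rw [← ENNReal.ofReal_prod_of_nonneg]
  · congr 1
    have : ∀ i, ((j i : ℝ) + 1) / ((N : ℝ) + 1) - (j i : ℝ) / ((N : ℝ) + 1)
        = ((N : ℝ) + 1)⁻¹ := fun i => by
      field_simp
      ring
    simp [this]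
  · intro i _
    rw [← sub_div]
    simp
    positivity

lemma fm_cell_dist (d N : ℕ) {x y : EuclideanSpace ℝ (Fin d)} (h : fmIdx d N x = fmIdx d N y) :
    ‖x - y‖ ≤ ((d : ℝ) + 1) / ((N : ℝ) + 1) := by
  have hN : (0 : ℝ) < (N : ℝ) + 1 := by positivity
  have hi : ∀ i, |x i - y i| ≤ 1 / ((N : ℝ) + 1) := by
    intro i
    have := Int.abs_sub_lt_one_of_floor_eq_floor (congrFun h i)
    rw [← mul_sub, abs_mul, abs_of_pos hN] at this
    rw [le_div_iff₀ hN, mul_comm]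
    exact this.le
  rw [EuclideanSpace.norm_eq]
  apply Real.sqrt_le_iff.2
  refine ⟨by positivity, ?_⟩
  calc ∑ i, ‖(x - y) i‖ ^ 2 ≤ ∑ i : Fin d, (1 / ((N : ℝ) + 1)) ^ 2 := by
        apply Finset.sum_le_sum
        intro i _
        gcongr
        simpa using hi i
    _ = d * (1 / ((N : ℝ) + 1)) ^ 2 := by simp
    _ ≤ ((d : ℝ) + 1) ^ 2 * (1 / ((N : ℝ) + 1)) ^ 2 := by
        gcongr
        nlinarith [(Nat.cast_nonneg d : (0 : ℝ) ≤ d)]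
    _ = _ := by ring

lemma fm_finite_idx (d N : ℕ) {Ω : Set (EuclideanSpace ℝ (Fin d))}
    (hΩb : Bornology.IsBounded Ω) : (fmIdx d N '' Ω).Finite := by
  obtain ⟨R, hR⟩ := hΩb.exists_norm_le
  have hN : (0 : ℝ) < (N : ℝ) + 1 := by positivity
  apply (Set.finite_Icc (fun _ : Fin d => ⌊-(((N : ℝ) + 1) * R)⌋)
    (fun _ : Fin d => ⌊((N : ℝ) + 1) * R⌋)).subset
  rintro _ ⟨x, hx, rfl⟩
  have hxi : ∀ i, |x i| ≤ R := fun i => by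
    have := PiLp.norm_apply_le x i
    rw [Real.norm_eq_abs] at this
    exact this.trans (hR x hx)
  constructor
  · intro i
    apply Int.floor_le_floor
    nlinarith [neg_le_of_abs_le (hxi i)]
  · intro i
    apply Int.floor_le_floor
    nlinarith [le_of_abs_le (hxi i)]

/-- per cell product of volumes summed is controlled by the perimeter -/
lemma fm_sum_prod_le (d N : ℕ) (α : ℝ) (hα : 0 < α) (E : Set (EuclideanSpace ℝ (Fin d)))
    (hE : MeasurableSet E) (J : Finset (Fin d → ℤ)) :
    ∑ j ∈ J, volume (E ∩ fmCell d N j) * volume (Eᶜ ∩ fmCell d N j) ≤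
      ENNReal.ofReal ((((d : ℝ) + 1) / ((N : ℝ) + 1)) ^ ((d : ℝ) + α)) * fracPer d α E := by
  set D : ℝ := ((d : ℝ) + 1) / ((N : ℝ) + 1) with hD
  have hDpos : 0 < D := by positivity
  set μ := ((volume : Measure (EuclideanSpace ℝ (Fin d))).prod
    (volume : Measure (EuclideanSpace ℝ (Fin d)))) with hμ
  have hcell : ∀ j, MeasurableSet ((E ∩ fmCell d N j) ×ˢ (Eᶜ ∩ fmCell d N j)) := fun j =>
    (hE.inter (fm_measurable_cell d N j)).prod (hE.compl.inter (fm_measurable_cell d N j))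
  have h1 : ∀ j ∈ J, volume (E ∩ fmCell d N j) * volume (Eᶜ ∩ fmCell d N j) ≤
      ∫⁻ p in (E ∩ fmCell d N j) ×ˢ (Eᶜ ∩ fmCell d N j),
        ENNReal.ofReal (D ^ ((d : ℝ) + α)) *
          ENNReal.ofReal (‖p.1 - p.2‖ ^ (-((d : ℝ) + α))) ∂μ := by
    intro j _
    rw [← Measure.prod_prod, ← hμ, ← setLIntegral_one]
    apply setLIntegral_mono' (hcell j)
    rintro ⟨x, y⟩ ⟨⟨hx, hxj⟩, ⟨hy, hyj⟩⟩
    have hne : 0 < ‖x - y‖ := by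
      rw [norm_pos_iff, sub_ne_zero]
      rintro rfl
      exact hy hx
    have hle : ‖x - y‖ ≤ D := fm_cell_dist d N (by
      rw [Set.mem_singleton_iff.1 hxj, Set.mem_singleton_iff.1 hyj])
    rw [← ENNReal.ofReal_mul (by positivity), ← ENNReal.ofReal_one]
    apply ENNReal.ofReal_le_ofReal
    simp only
    rw [Real.rpow_neg hne.le, ← div_eq_mul_inv, one_le_div (by positivity)]
    exact Real.rpow_le_rpow hne.le hle (by positivity)
  calc _ ≤ ∑ j ∈ J, ∫⁻ p in (E ∩ fmCell d N j) ×ˢ (Eᶜ ∩ fmCell d N j),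
        ENNReal.ofReal (D ^ ((d : ℝ) + α)) *
          ENNReal.ofReal (‖p.1 - p.2‖ ^ (-((d : ℝ) + α))) ∂μ := Finset.sum_le_sum h1
    _ = ∫⁻ p in ⋃ j ∈ J, (E ∩ fmCell d N j) ×ˢ (Eᶜ ∩ fmCell d N j),
        ENNReal.ofReal (D ^ ((d : ℝ) + α)) *
          ENNReal.ofReal (‖p.1 - p.2‖ ^ (-((d : ℝ) + α))) ∂μ := by
        rw [lintegral_biUnion_finset _ (fun j _ => hcell j)]
        intro j _ k _ hjk
        refine Set.disjoint_left.2 ?_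
        rintro ⟨x, y⟩ ⟨⟨_, hxj⟩, _⟩ ⟨⟨_, hxk⟩, _⟩
        exact hjk ((Set.mem_singleton_iff.1 hxj).symm.trans (Set.mem_singleton_iff.1 hxk))
    _ ≤ ∫⁻ p in E ×ˢ Eᶜ, ENNReal.ofReal (D ^ ((d : ℝ) + α)) *
          ENNReal.ofReal (‖p.1 - p.2‖ ^ (-((d : ℝ) + α))) ∂μ := by
        apply lintegral_mono_set
        refine Set.iUnion₂_subset fun j _ => ?_
        exact Set.prod_mono Set.inter_subset_left Set.inter_subset_left
    _ = ENNReal.ofReal (D ^ ((d : ℝ) + α)) * ∫⁻ p in E ×ˢ Eᶜ,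
          ENNReal.ofReal (‖p.1 - p.2‖ ^ (-((d : ℝ) + α))) ∂μ :=
        lintegral_const_mul _ (fm_meas_kernel d α)
    _ ≤ _ := by
        rw [fm_fracPer_eq]
        gcongr
        nth_rw 1 [← one_mul (∫⁻ p in E ×ˢ Eᶜ, _ ∂μ)]
        gcongr
        norm_num

lemma fm_arith {a b q s : ℝ} (ha : 0 ≤ a) (haq : a ≤ q) (hq : 0 < q)
    (h1 : s ≤ a + b) (h2 : s ≤ 2 * q - a - b) : s ≤ 4 / q * (a * (q - a)) + |a - b| := by
  have e1 := le_abs_self (a - b)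
  have e2 := neg_abs_le (a - b)
  have key : 2 * min a (q - a) ≤ 4 / q * (a * (q - a)) := by
    rw [div_mul_eq_mul_div, le_div_iff₀ hq]
    rcases le_total a (q - a) with h | h
    · rw [min_eq_left h]; nlinarith
    · rw [min_eq_right h]; nlinarith
  rcases le_total a (q - a) with h | h
  · rw [min_eq_left h] at key; linarith
  · rw [min_eq_right h] at key; linarith

lemma fm_symm_est (d N : ℕ) (α : ℝ) (hα : 0 < α) (E E' Ω : Set (EuclideanSpace ℝ (Fin d)))
    (hE : MeasurableSet E) (hE' : MeasurableSet E') (hEΩ : E ⊆ Ω) (hEΩ' : E' ⊆ Ω)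
    (J : Finset (Fin d → ℤ)) (hJ : fmIdx d N '' Ω ⊆ J) (hP : fracPer d α E ≠ ⊤) :
    volume (E ∆ E') ≤ ENNReal.ofReal (4 * ((N : ℝ) + 1) ^ d *
      ((((d : ℝ) + 1) / ((N : ℝ) + 1)) ^ ((d : ℝ) + α)) * (fracPer d α E).toReal +
      ∑ j ∈ J, |volume.real (E ∩ fmCell d N j) - volume.real (E' ∩ fmCell d N j)|) := by
  set q : ℝ := (((N : ℝ) + 1) ^ d)⁻¹ with hqdef
  have hq : 0 < q := by positivity
  have hcfin : ∀ j, volume (fmCell d N j) ≠ ⊤ := fun j => by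
    rw [fm_cell_volume]; exact ENNReal.ofReal_ne_top
  have hcr : ∀ j, volume.real (fmCell d N j) = q := fun j => by
    rw [Measure.real, fm_cell_volume, ENNReal.toReal_ofReal hq.le]
  have hsub : E ∆ E' ⊆ ⋃ j ∈ J, (E ∆ E') ∩ fmCell d N j := by
    intro x hx
    have hxΩ : x ∈ Ω := by
      rcases hx with h | h
      · exact hEΩ h.1
      · exact hEΩ' h.1
    simp only [Set.mem_iUnion]
    exact ⟨fmIdx d N x, hJ ⟨x, hxΩ, rfl⟩, hx, rfl⟩
  have hcompl : ∀ (A : Set (EuclideanSpace ℝ (Fin d))) (j), MeasurableSet A →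
      volume.real (Aᶜ ∩ fmCell d N j) = q - volume.real (A ∩ fmCell d N j) := by
    intro A j hA
    have := measureReal_inter_add_sdiff₀ (μ := volume) (s := fmCell d N j) (t := A)
      hA.nullMeasurableSet (hcfin j)
    rw [hcr, Set.sdiff_eq, Set.inter_comm, Set.inter_comm _ Aᶜ] at this
    linarith
  have hcellest : ∀ j, volume.real ((E ∆ E') ∩ fmCell d N j) ≤
      4 / q * (volume.real (E ∩ fmCell d N j) * volume.real (Eᶜ ∩ fmCell d N j)) +
      |volume.real (E ∩ fmCell d N j) - volume.real (E' ∩ fmCell d N j)| := by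
    intro j
    have hf : ∀ A : Set (EuclideanSpace ℝ (Fin d)), volume (A ∩ fmCell d N j) ≠ ⊤ := fun A =>
      measure_ne_top_of_subset Set.inter_subset_right (hcfin j)
    rw [hcompl E j hE]
    apply fm_arith measureReal_nonneg _ hq
    · refine le_trans (measureReal_mono ?_ ?_) (measureReal_union_le _ _)
      · rintro x ⟨h | h, hj⟩
        · exact Or.inl ⟨h.1, hj⟩
        · exact Or.inr ⟨h.1, hj⟩
      · exact (measure_union_lt_top (hf _).lt_top (hf _).lt_top).ne
    · have : volume.real ((E ∆ E') ∩ fmCell d N j) ≤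
        volume.real (Eᶜ ∩ fmCell d N j) + volume.real (E'ᶜ ∩ fmCell d N j) := by
        refine le_trans (measureReal_mono ?_ ?_) (measureReal_union_le _ _)
        · rintro x ⟨h | h, hj⟩
          · exact Or.inr ⟨h.2, hj⟩
          · exact Or.inl ⟨h.2, hj⟩
        · exact (measure_union_lt_top (hf _).lt_top (hf _).lt_top).ne
      rw [hcompl E j hE, hcompl E' j hE'] at this
      linarith
    · rw [← hcr j]
      exact measureReal_mono Set.inter_subset_right (hcfin j)
  have hprod : ∑ j ∈ J, volume.real (E ∩ fmCell d N j) * volume.real (Eᶜ ∩ fmCell d N j) ≤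
      ((((d : ℝ) + 1) / ((N : ℝ) + 1)) ^ ((d : ℝ) + α)) * (fracPer d α E).toReal := by
    have := ENNReal.toReal_mono (ENNReal.mul_ne_top ENNReal.ofReal_ne_top hP)
      (fm_sum_prod_le d N α hα E hE J)
    rw [ENNReal.toReal_mul, ENNReal.toReal_ofReal (by positivity), ENNReal.toReal_sum] at this
    · simp only [ENNReal.toReal_mul] at this
      exact this
    · intro j _
      exact ENNReal.mul_ne_top (measure_ne_top_of_subset Set.inter_subset_right (hcfin j))
        (measure_ne_top_of_subset Set.inter_subset_right (hcfin j))
  calc volume (E ∆ E') ≤ ∑ j ∈ J, volume ((E ∆ E') ∩ fmCell d N j) :=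
        (measure_mono hsub).trans (measure_biUnion_finset_le _ _)
    _ = ENNReal.ofReal (∑ j ∈ J, volume.real ((E ∆ E') ∩ fmCell d N j)) := by
        rw [ENNReal.ofReal_sum_of_nonneg (fun _ _ => measureReal_nonneg)]
        refine Finset.sum_congr rfl fun j _ => ?_
        rw [ofReal_measureReal (measure_ne_top_of_subset Set.inter_subset_right (hcfin j))]
    _ ≤ _ := by
        apply ENNReal.ofReal_le_ofReal
        refine (Finset.sum_le_sum fun j _ => hcellest j).trans ?_
        rw [Finset.sum_add_distrib, ← Finset.mul_sum]
        refine add_le_add ?_ le_rfl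
        refine (mul_le_mul_of_nonneg_left hprod (by positivity)).trans_eq ?_
        rw [hqdef]; field_simp

lemma fm_coef_tendsto (d : ℕ) (α : ℝ) (hα : 0 < α) (C : ℝ) :
    Tendsto (fun N : ℕ => 4 * ((N : ℝ) + 1) ^ d *
      ((((d : ℝ) + 1) / ((N : ℝ) + 1)) ^ ((d : ℝ) + α)) * C) atTop (nhds 0) := by
  have h : ∀ N : ℕ, 4 * ((N : ℝ) + 1) ^ d *
      ((((d : ℝ) + 1) / ((N : ℝ) + 1)) ^ ((d : ℝ) + α)) * C =
      (4 * ((d : ℝ) + 1) ^ ((d : ℝ) + α) * C) * ((N : ℝ) + 1) ^ (-α) := by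
    intro N
    have hN : (0 : ℝ) < (N : ℝ) + 1 := by positivity
    rw [Real.div_rpow (by positivity) hN.le, Real.rpow_add hN, Real.rpow_neg hN.le,
      Real.rpow_natCast]
    field_simp
  simp_rw [h]
  have h2 : Tendsto (fun N : ℕ => ((N : ℝ) + 1) ^ (-α)) atTop (nhds 0) :=
    (tendsto_rpow_neg_atTop hα).comp
      (tendsto_atTop_add_const_right _ _ tendsto_natCast_atTop_atTop)
  simpa using h2.const_mul (4 * ((d : ℝ) + 1) ^ ((d : ℝ) + α) * C)

lemma fm_cauchy (d : ℕ) (α : ℝ) (hα : 0 < α) (Ω : Set (EuclideanSpace ℝ (Fin d)))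
    (hΩb : Bornology.IsBounded Ω) (E : ℕ → Set (EuclideanSpace ℝ (Fin d)))
    (hE : ∀ n, MeasurableSet (E n)) (hEΩ : ∀ n, E n ⊆ Ω) (C : ℝ)
    (hC : ∀ n, fracPer d α (E n) ≤ ENNReal.ofReal C)
    (hconv : ∀ N j, ∃ l : ℝ, Tendsto (fun n => volume.real (E n ∩ fmCell d N j)) atTop (nhds l))
    (ε : ℝ) (hε : 0 < ε) :
    ∃ K, ∀ n ≥ K, ∀ m ≥ K, volume (E n ∆ E m) ≤ ENNReal.ofReal ε := by
  have hC0 : ∀ n, (fracPer d α (E n)).toReal ≤ max C 0 := fun n => by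
    refine (ENNReal.toReal_mono ENNReal.ofReal_ne_top (hC n)).trans ?_
    rw [ENNReal.toReal_ofReal']
  obtain ⟨N, hN⟩ := ((fm_coef_tendsto d α hα (max C 0)).eventually
    (gt_mem_nhds (half_pos hε))).exists
  set J := (fm_finite_idx d N hΩb).toFinset with hJ
  have hs : Tendsto (fun p : ℕ × ℕ => ∑ j ∈ J, |volume.real (E p.1 ∩ fmCell d N j) -
      volume.real (E p.2 ∩ fmCell d N j)|) atTop (nhds 0) := by
    rw [← Finset.sum_const_zero (s := J) (ι := Fin d → ℤ) (M := ℝ)]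
    refine tendsto_finsetSum _ fun j _ => ?_
    obtain ⟨l, hl⟩ := hconv N j
    rw [← prod_atTop_atTop_eq]
    have := ((hl.comp tendsto_fst).sub (hl.comp (tendsto_snd (f := (atTop : Filter ℕ))))).abs
    simpa using this
  have hev := hs.eventually (gt_mem_nhds (half_pos hε))
  rw [eventually_atTop_prod_self] at hev
  obtain ⟨K, hK⟩ := hev
  refine ⟨K, fun n hn m hm => ?_⟩
  refine (fm_symm_est d N α hα (E n) (E m) Ω (hE n) (hE m) (hEΩ n) (hEΩ m) J
    (by simp [hJ]) (ne_top_of_le_ne_top ENNReal.ofReal_ne_top (hC n))).trans ?_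
  apply ENNReal.ofReal_le_ofReal
  have h1 := hK n m hn hm
  have h2 := mul_le_mul_of_nonneg_left (hC0 n)
    (show 0 ≤ 4 * ((N : ℝ) + 1) ^ d * ((((d : ℝ) + 1) / ((N : ℝ) + 1)) ^ ((d : ℝ) + α)) by
      positivity)
  linarith

/-- Cauchy for the measure of the disagreement set gives an a.e. eventually constant
subsequence. -/
lemma fm_limit {X : Type*} [MeasurableSpace X] (μ : Measure X) (w : ℕ → X → ℝ)
    (hw : ∀ n, Measurable (w n))
    (hc : ∀ ε : ℝ, 0 < ε → ∃ K, ∀ n ≥ K, ∀ m ≥ K, μ {x | w n x ≠ w m x} ≤ ENNReal.ofReal ε) :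
    ∃ φ : ℕ → ℕ, StrictMono φ ∧ ∃ f : X → ℝ, Measurable f ∧
      ∀ᵐ x ∂μ, ∀ᶠ k in atTop, w (φ k) x = f x := by
  have h0 : ∀ k : ℕ, ∃ K, ∀ n ≥ K, (∀ m ≥ n, μ {x | w n x ≠ w m x} ≤
      ENNReal.ofReal ((1 / 2 : ℝ) ^ k)) := by
    intro k
    obtain ⟨K, hK⟩ := hc ((1 / 2 : ℝ) ^ k) (by positivity)
    exact ⟨K, fun n hn m hm => hK n hn m (hn.le.trans hm)⟩
  obtain ⟨φ, hφ, hφ2⟩ := extraction_forall_of_eventually' h0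
  refine ⟨φ, hφ, ?_⟩
  have hsum : ∑' k, μ {x | w (φ k) x ≠ w (φ (k + 1)) x} ≠ ⊤ := by
    refine ne_top_of_le_ne_top ?_ (ENNReal.tsum_le_tsum fun k =>
      hφ2 k (φ (k + 1)) (hφ (Nat.lt_succ_self k)).le)
    rw [← ENNReal.ofReal_tsum_of_nonneg (fun k => by positivity)
      (summable_geometric_of_lt_one (by norm_num) (by norm_num))]
    exact ENNReal.ofReal_ne_top
  have hae : ∀ᵐ x ∂μ, ∃ K, ∀ k ≥ K, w (φ k) x = w (φ K) x := by
    filter_upwards [ae_eventually_notMem hsum] with x hx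
    obtain ⟨K, hK⟩ := eventually_atTop.1 hx
    refine ⟨K, fun k hk => ?_⟩
    induction k, hk using Nat.le_induction with
    | base => rfl
    | succ k hk ih =>
      rw [← ih]
      have := hK k hk
      simp only [not_not] at this
      exact this.symm
  obtain ⟨f, hf, hlim⟩ := measurable_limit_of_tendsto_metrizable_ae (μ := μ) (L := atTop)
    (f := fun k => w (φ k)) (fun n => (hw _).aemeasurable) (by
      filter_upwards [hae] with x hx
      obtain ⟨K, hK⟩ := hx
      exact ⟨w (φ K) x, tendsto_const_nhds.congr' (by
        filter_upwards [eventually_ge_atTop K] with k hk using (hK k hk).symm)⟩)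
  refine ⟨f, hf, ?_⟩
  filter_upwards [hae, hlim] with x hx hl
  obtain ⟨K, hK⟩ := hx
  have : f x = w (φ K) x := tendsto_nhds_unique hl (tendsto_const_nhds.congr' (by
        filter_upwards [eventually_ge_atTop K] with k hk using (hK k hk).symm))
  filter_upwards [eventually_ge_atTop K] with k hk
  rw [this, hK k hk]

/-- compactness -/
lemma fm_compact (d M : ℕ) (α : ℝ) (hα : 0 < α)
    (Ω : Set (EuclideanSpace ℝ (Fin d))) (hΩm : MeasurableSet Ω)
    (hΩb : Bornology.IsBounded Ω) (wv : Fin M → ℤ)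
    (w : ℕ → EuclideanSpace ℝ (Fin d) → ℝ) (hw : ∀ n, Feasible d M Ω wv (w n)) (C : ℝ)
    (hC : ∀ n i, wv i ≠ 0 → fracPer d α (w n ⁻¹' {(wv i : ℝ)}) ≤ ENNReal.ofReal C) :
    ∃ φ : ℕ → ℕ, StrictMono φ ∧ ∃ f, Feasible d M Ω wv f ∧
      ∀ᵐ x, ∀ᶠ k in atTop, w (φ k) x = f x := by
  have hΩfin : volume Ω ≠ ⊤ := hΩb.measure_lt_top.ne
  -- extraction along the cells
  let T : ℕ → (Fin M × ℕ × (Fin d → ℤ)) → ℝ := fun n t =>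
    volume.real (w n ⁻¹' {(wv t.1 : ℝ)} ∩ fmCell d t.2.1 t.2.2)
  have hT : ∀ n, T n ∈ Set.univ.pi (fun t : Fin M × ℕ × (Fin d → ℤ) =>
      Set.Icc (0 : ℝ) (volume.real (fmCell d t.2.1 t.2.2))) := by
    intro n t _
    refine ⟨measureReal_nonneg, measureReal_mono Set.inter_subset_right ?_⟩
    rw [fm_cell_volume]; exact ENNReal.ofReal_ne_top
  obtain ⟨l, -, ψ, hψ, hl⟩ :=
    (isCompact_univ_pi fun t : Fin M × ℕ × (Fin d → ℤ) =>
      isCompact_Icc (a := (0 : ℝ)) (b := volume.real (fmCell d t.2.1 t.2.2))).tendsto_subseq hT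
  rw [tendsto_pi_nhds] at hl
  have hsubΩ : ∀ n i, wv i ≠ 0 → w n ⁻¹' {(wv i : ℝ)} ⊆ Ω := by
    intro n i hi x hx
    by_contra hxΩ
    have h1 := (hw n).2.1 x hxΩ
    rw [Set.mem_preimage, Set.mem_singleton_iff, h1] at hx
    exact hi (by exact_mod_cast hx.symm)
  have hcau : ∀ ε : ℝ, 0 < ε → ∀ i, wv i ≠ 0 → ∃ K, ∀ n ≥ K, ∀ m ≥ K,
      volume ((w (ψ n) ⁻¹' {(wv i : ℝ)}) ∆ (w (ψ m) ⁻¹' {(wv i : ℝ)})) ≤ ENNReal.ofReal ε := by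
    intro ε hε i hi
    exact fm_cauchy d α hα Ω hΩb (fun n => w (ψ n) ⁻¹' {(wv i : ℝ)})
      (fun n => (hw _).1 (measurableSet_singleton _)) (fun n => hsubΩ _ i hi) C
      (fun n => hC _ i hi) (fun N j => ⟨_, hl (i, N, j)⟩) ε hε
  have hvals : ∀ n, ∀ᵐ x, x ∈ Ω → ∃ i, w n x = (wv i : ℝ) := fun n =>
    (ae_restrict_iff' hΩm).1 (hw n).2.2
  obtain ⟨χ, hχ, f, hf, hlim⟩ := fm_limit volume (fun n => w (ψ n)) (fun n => (hw _).1) (by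
    intro ε hε
    have hM : (0 : ℝ) < (M : ℝ) + 1 := by positivity
    have : ∀ i, ∃ K, wv i ≠ 0 → ∀ n ≥ K, ∀ m ≥ K,
      volume ((w (ψ n) ⁻¹' {(wv i : ℝ)}) ∆ (w (ψ m) ⁻¹' {(wv i : ℝ)})) ≤
        ENNReal.ofReal (ε / ((M : ℝ) + 1)) := by
      intro i
      by_cases hi : wv i = 0
      · exact ⟨0, fun h => absurd hi h⟩
      · obtain ⟨K, hK⟩ := hcau (ε / ((M : ℝ) + 1)) (by positivity) i hi
        exact ⟨K, fun _ => hK⟩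
    choose K hK using this
    refine ⟨∑ i, K i, fun n hn m hm => ?_⟩
    have hKi : ∀ i, K i ≤ ∑ i, K i := fun i =>
      Finset.single_le_sum (f := K) (fun _ _ => Nat.zero_le _) (Finset.mem_univ i)
    let S : Fin M → Set (EuclideanSpace ℝ (Fin d)) := fun i =>
      if wv i = 0 then ∅ else (w (ψ n) ⁻¹' {(wv i : ℝ)}) ∆ (w (ψ m) ⁻¹' {(wv i : ℝ)})
    have hS : volume {x | w (ψ n) x ≠ w (ψ m) x} ≤ volume (⋃ i, S i) := by
      apply measure_mono_ae
      filter_upwards [hvals (ψ n), hvals (ψ m)] with x h1 h2 hx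
      have hx' : w (ψ n) x ≠ w (ψ m) x := hx
      have hxΩ : x ∈ Ω := by
        by_contra h
        exact hx' (((hw _).2.1 x h).trans ((hw _).2.1 x h).symm)
      obtain ⟨i, hi⟩ := h1 hxΩ
      obtain ⟨j, hj⟩ := h2 hxΩ
      by_cases hi0 : wv i = 0
      · have hj0 : wv j ≠ 0 := by
          intro hj0
          apply hx'
          rw [hi, hj, hi0, hj0]
        refine Set.mem_iUnion.2 ⟨j, ?_⟩
        simp only [S, if_neg hj0]
        exact Or.inr ⟨hj, fun h => hx' (Eq.trans h hj.symm)⟩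
      · refine Set.mem_iUnion.2 ⟨i, ?_⟩
        simp only [S, if_neg hi0]
        exact Or.inl ⟨hi, fun h => hx' (hi.trans (Eq.symm h))⟩
    refine hS.trans ((measure_iUnion_fintype_le _ _).trans ?_)
    calc ∑ i, volume (S i) ≤ ∑ i : Fin M, ENNReal.ofReal (ε / ((M : ℝ) + 1)) := by
          refine Finset.sum_le_sum fun i _ => ?_
          by_cases hi : wv i = 0
          · simp [S, hi]
          · simp only [S, if_neg hi]
            exact hK i hi n ((hKi i).trans hn) m ((hKi i).trans hm)
      _ = ENNReal.ofReal (M * (ε / ((M : ℝ) + 1))) := by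
          rw [ENNReal.ofReal_mul (by positivity)]
          simp
      _ ≤ ENNReal.ofReal ε := by
          apply ENNReal.ofReal_le_ofReal
          rw [mul_div_assoc', div_le_iff₀ hM]
          nlinarith)
  have hlim' : ∀ᵐ x, ∀ᶠ k in atTop, w (ψ (χ k)) x = Ω.indicator f x := by
    filter_upwards [hlim] with x hx
    by_cases hxΩ : x ∈ Ω
    · simpa [hxΩ] using hx
    · simp only [Set.indicator_of_notMem hxΩ]
      exact Eventually.of_forall fun k => (hw _).2.1 x hxΩ
  refine ⟨ψ ∘ χ, hψ.comp hχ, Ω.indicator f, ⟨hf.indicator hΩm, ?_, ?_⟩, hlim'⟩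
  · intro x hx
    exact Set.indicator_of_notMem hx f
  · rw [ae_restrict_iff' hΩm]
    filter_upwards [hlim', ae_all_iff.2 hvals] with x h1 h2 hx
    obtain ⟨k, hk⟩ := h1.exists
    rw [← hk]
    exact h2 _ hx

/-- lower semicontinuity of the regularizer -/
lemma fm_lsc (d M : ℕ) (α : ℝ) (wv : Fin M → ℤ)
    (w : ℕ → EuclideanSpace ℝ (Fin d) → ℝ) (hw : ∀ n, Measurable (w n))
    (f : EuclideanSpace ℝ (Fin d) → ℝ) (hf : Measurable f)
    (hlim : ∀ᵐ x, ∀ᶠ k in atTop, w k x = f x) :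
    Reg d M α wv f ≤ liminf (fun n => Reg d M α wv (w n)) atTop := by
  classical
  set μ := ((volume : Measure (EuclideanSpace ℝ (Fin d))).prod
    (volume : Measure (EuclideanSpace ℝ (Fin d)))) with hμ
  let c : Fin M → ℝ≥0∞ := fun i => ((wv i).natAbs : ℝ≥0∞) * ENNReal.ofReal (1 - α) * 2
  let h : (EuclideanSpace ℝ (Fin d) → ℝ) →
      EuclideanSpace ℝ (Fin d) × EuclideanSpace ℝ (Fin d) → ℝ≥0∞ := fun u p =>
    ∑ i, c i * (if u p.1 = (wv i : ℝ) ∧ u p.2 ≠ (wv i : ℝ) then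
      ENNReal.ofReal (‖p.1 - p.2‖ ^ (-((d : ℝ) + α))) else 0)
  have hset : ∀ u : EuclideanSpace ℝ (Fin d) → ℝ, Measurable u → ∀ i, MeasurableSet
      {p : EuclideanSpace ℝ (Fin d) × EuclideanSpace ℝ (Fin d) |
        u p.1 = (wv i : ℝ) ∧ u p.2 ≠ (wv i : ℝ)} := fun u hu i =>
    ((hu.comp measurable_fst) (measurableSet_singleton _)).inter
      ((hu.comp measurable_snd) (measurableSet_singleton _)).compl
  have hterm : ∀ u : EuclideanSpace ℝ (Fin d) → ℝ, Measurable u → ∀ i, Measurable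
      (fun p : EuclideanSpace ℝ (Fin d) × EuclideanSpace ℝ (Fin d) =>
      (if u p.1 = (wv i : ℝ) ∧ u p.2 ≠ (wv i : ℝ) then
      ENNReal.ofReal (‖p.1 - p.2‖ ^ (-((d : ℝ) + α))) else 0)) := fun u hu i =>
    Measurable.ite (hset u hu i) (fm_meas_kernel d α) measurable_const
  have hmeas : ∀ u, Measurable u → Measurable (h u) := fun u hu =>
    Finset.measurable_fun_sum _ fun i _ => (hterm u hu i).const_mul _
  have hReg : ∀ u, Measurable u → Reg d M α wv u = ∫⁻ p, h u p ∂μ := by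
    intro u hu
    simp only [h]
    rw [lintegral_finsetSum _ fun i _ => (hterm u hu i).const_mul _]
    unfold Reg
    refine Finset.sum_congr rfl fun i _ => ?_
    rw [lintegral_const_mul _ (hterm u hu i), fm_fracPer_eq, ← mul_assoc,
      ← lintegral_indicator]
    · congr 1
      refine lintegral_congr fun p => ?_
      simp [Set.indicator_apply, Set.mem_prod]
    · exact (hu (measurableSet_singleton _)).prod (hu (measurableSet_singleton _)).compl
  rw [hReg f hf]
  simp_rw [fun n => hReg (w n) (hw n)]
  refine le_trans (lintegral_mono_ae ?_) (lintegral_liminf_le fun n => hmeas _ (hw n))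
  have h1 : ∀ᵐ p ∂μ, ∀ᶠ k in atTop, w k p.1 = f p.1 :=
    Measure.quasiMeasurePreserving_fst.ae hlim
  have h2 : ∀ᵐ p ∂μ, ∀ᶠ k in atTop, w k p.2 = f p.2 :=
    Measure.quasiMeasurePreserving_snd.ae hlim
  filter_upwards [h1, h2] with p hp1 hp2
  have : Tendsto (fun k => h (w k) p) atTop (nhds (h f p)) := by
    refine tendsto_const_nhds.congr' ?_
    filter_upwards [hp1, hp2] with k e1 e2
    simp only [h, e1, e2]
  rw [this.liminf_eq]

/-- `L²` convergence -/
lemma fm_L2 (d M : ℕ)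
    (Ω : Set (EuclideanSpace ℝ (Fin d))) (hΩm : MeasurableSet Ω)
    (hΩb : Bornology.IsBounded Ω) (wv : Fin M → ℤ)
    (w : ℕ → EuclideanSpace ℝ (Fin d) → ℝ) (hw : ∀ n, Feasible d M Ω wv (w n))
    (f : EuclideanSpace ℝ (Fin d) → ℝ) (hf : Feasible d M Ω wv f)
    (hlim : ∀ᵐ x, ∀ᶠ k in atTop, w k x = f x) :
    Tendsto (fun n => ∫⁻ x, ENNReal.ofReal ((w n x - f x) ^ 2)) atTop (nhds 0) := by
  set A : ℝ := ∑ i, |(wv i : ℝ)| with hA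
  have hAi : ∀ i, |(wv i : ℝ)| ≤ A := fun i =>
    Finset.single_le_sum (f := fun i => |(wv i : ℝ)|) (fun _ _ => abs_nonneg _) (Finset.mem_univ i)
  have hbd : ∀ u, Feasible d M Ω wv u → ∀ᵐ x, x ∈ Ω → |u x| ≤ A := fun u hu => by
    filter_upwards [(ae_restrict_iff' hΩm).1 hu.2.2] with x hx hxΩ
    obtain ⟨i, hi⟩ := hx hxΩ
    rw [hi]; exact hAi i
  rw [← lintegral_zero (α := EuclideanSpace ℝ (Fin d)) (μ := volume)]
  refine tendsto_lintegral_of_dominated_convergence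
    (Ω.indicator fun _ => ENNReal.ofReal ((2 * A) ^ 2)) ?_ ?_ ?_ ?_
  · intro n
    exact (((hw n).1.sub hf.1).pow_const 2).ennreal_ofReal
  · intro n
    filter_upwards [hbd _ (hw n), hbd _ hf] with x h1 h2
    by_cases hx : x ∈ Ω
    · rw [Set.indicator_of_mem hx]
      apply ENNReal.ofReal_le_ofReal
      apply sq_le_sq'
      · linarith [neg_le_of_abs_le (h1 hx), le_of_abs_le (h2 hx)]
      · linarith [neg_le_of_abs_le (h2 hx), le_of_abs_le (h1 hx)]
    · simp [(hw n).2.1 x hx, hf.2.1 x hx]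
  · rw [lintegral_indicator hΩm, setLIntegral_const]
    exact ENNReal.mul_ne_top ENNReal.ofReal_ne_top hΩb.measure_lt_top.ne
  · filter_upwards [hlim] with x hx
    refine tendsto_const_nhds.congr' ?_
    filter_upwards [hx] with k hk
    simp [hk]

/-- Existence of a minimizer of `J_α(w) = F(w) + η R_α(w)` over the `W`-valued functions,
where `F` is bounded below and continuous along `L²`-convergent feasible sequences. -/
theorem exists_minimizer (d M : ℕ) (hM : 0 < M) (α η : ℝ)
    (hα : α ∈ Set.Ioo (0 : ℝ) 1) (hη : 0 < η)
    (Ω : Set (EuclideanSpace ℝ (Fin d))) (hΩm : MeasurableSet Ω)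
    (hΩb : Bornology.IsBounded Ω)
    (wv : Fin M → ℤ) (hinj : Function.Injective wv)
    (F : (EuclideanSpace ℝ (Fin d) → ℝ) → ℝ) (B : ℝ) (hFbd : ∀ u, B ≤ F u)
    (hFcont : ∀ (u : ℕ → EuclideanSpace ℝ (Fin d) → ℝ) (v : EuclideanSpace ℝ (Fin d) → ℝ),
      (∀ n, Feasible d M Ω wv (u n)) → Feasible d M Ω wv v →
      Tendsto (fun n => ∫⁻ x, ENNReal.ofReal ((u n x - v x) ^ 2)) atTop (nhds 0) →
      Tendsto (fun n => F (u n)) atTop (nhds (F v))) :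
    ∃ w, Feasible d M Ω wv w ∧
      ∀ v, Feasible d M Ω wv v →
        ((F w : EReal) + ((ENNReal.ofReal η * Reg d M α wv w : ℝ≥0∞) : EReal)
          ≤ (F v : EReal) + ((ENNReal.ofReal η * Reg d M α wv v : ℝ≥0∞) : EReal)) := by
  classical
  obtain ⟨hα0, hα1⟩ := hα
  by_cases hall : ∀ v, Feasible d M Ω wv v → Reg d M α wv v = ⊤
  · have hf0 : Feasible d M Ω wv (Ω.indicator fun _ => (wv ⟨0, hM⟩ : ℝ)) := by
      refine ⟨measurable_const.indicator hΩm, fun x hx => Set.indicator_of_notMem hx _, ?_⟩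
      rw [ae_restrict_iff' hΩm]
      exact Eventually.of_forall fun x hx => ⟨⟨0, hM⟩, Set.indicator_of_mem hx _⟩
    refine ⟨_, hf0, fun v hv => ?_⟩
    rw [hall v hv, ENNReal.mul_top (by simpa using hη)]
    simp
  push Not at hall
  obtain ⟨v0, hv0, hv0fin⟩ := hall
  let S : Set ℝ := {r | ∃ v, Feasible d M Ω wv v ∧ Reg d M α wv v ≠ ⊤ ∧
    r = F v + η * (Reg d M α wv v).toReal}
  have hSne : S.Nonempty := ⟨_, v0, hv0, hv0fin, rfl⟩
  have hSbd : BddBelow S := by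
    refine ⟨B, ?_⟩
    rintro _ ⟨v, -, -, rfl⟩
    have := hFbd v
    have : 0 ≤ η * (Reg d M α wv v).toReal := by positivity
    linarith
  obtain ⟨s, hsanti, hslim, hsS⟩ := exists_seq_tendsto_sInf hSne hSbd
  choose u hu hufin hus using hsS
  have h1α : 0 < 1 - α := by linarith
  have hRbd : ∀ n, (Reg d M α wv (u n)).toReal ≤ (s 0 - B) / η := by
    intro n
    rw [le_div_iff₀ hη]
    have h1 := hsanti (Nat.zero_le n)
    have h2 := hus n
    have h3 := hFbd (u n)
    linarith
  have hP : ∀ n i, wv i ≠ 0 → fracPer d α (u n ⁻¹' {(wv i : ℝ)}) ≤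
      ENNReal.ofReal ((s 0 - B) / η / (1 - α)) := by
    intro n i hi
    have h1 : ((wv i).natAbs : ℝ≥0∞) * ENNReal.ofReal (1 - α) *
        fracPer d α (u n ⁻¹' {(wv i : ℝ)}) ≤ Reg d M α wv (u n) :=
      Finset.single_le_sum (f := fun i => ((wv i).natAbs : ℝ≥0∞) * ENNReal.ofReal (1 - α) *
        fracPer d α (u n ⁻¹' {(wv i : ℝ)})) (fun _ _ => zero_le) (Finset.mem_univ i)
    have h2 : Reg d M α wv (u n) ≤ ENNReal.ofReal ((s 0 - B) / η) := by
      rw [← ENNReal.ofReal_toReal (hufin n)]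
      exact ENNReal.ofReal_le_ofReal (hRbd n)
    rw [ENNReal.ofReal_div_of_pos h1α, ENNReal.le_div_iff_mul_le
      (Or.inl (by simpa using h1α)) (Or.inl ENNReal.ofReal_ne_top)]
    refine le_trans ?_ (h1.trans h2)
    rw [mul_comm]
    gcongr
    nth_rw 1 [← one_mul (ENNReal.ofReal (1 - α))]
    gcongr
    exact_mod_cast Nat.one_le_iff_ne_zero.2 (Int.natAbs_ne_zero.2 hi)
  obtain ⟨φ, hφ, w, hw, hlim⟩ := fm_compact d M α hα0 Ω hΩm hΩb wv u hu _ hP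
  have hF : Tendsto (fun k => F (u (φ k))) atTop (nhds (F w)) :=
    hFcont _ _ (fun k => hu _) hw
      (fm_L2 d M Ω hΩm hΩb wv (fun k => u (φ k)) (fun k => hu _) w hw hlim)
  have hlsc := fm_lsc d M α wv (fun k => u (φ k)) (fun k => (hu _).1) w hw.1 hlim
  have hRt : Tendsto (fun k => Reg d M α wv (u (φ k))) atTop
      (nhds (ENNReal.ofReal ((sInf S - F w) / η))) := by
    have h1 : ∀ k, Reg d M α wv (u (φ k)) = ENNReal.ofReal ((s (φ k) - F (u (φ k))) / η) := by
      intro k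
      rw [hus (φ k), add_sub_cancel_left, mul_div_cancel_left₀ _ hη.ne',
        ENNReal.ofReal_toReal (hufin _)]
    simp_rw [h1]
    exact ENNReal.tendsto_ofReal
      (((hslim.comp hφ.tendsto_atTop).sub hF).div_const η)
  rw [hRt.liminf_eq] at hlsc
  have hnn : 0 ≤ (sInf S - F w) / η := by
    refine div_nonneg ?_ hη.le
    refine ge_of_tendsto' ((hslim.comp hφ.tendsto_atTop).sub hF) fun k => ?_
    have h2 : 0 ≤ η * (Reg d M α wv (u (φ k))).toReal := by positivity
    have h3 := hus (φ k)
    simp only [Function.comp]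
    linarith
  have hwfin : Reg d M α wv w ≠ ⊤ := ne_top_of_le_ne_top ENNReal.ofReal_ne_top hlsc
  have hwle : F w + η * (Reg d M α wv w).toReal ≤ sInf S := by
    have := ENNReal.toReal_mono ENNReal.ofReal_ne_top hlsc
    rw [ENNReal.toReal_ofReal hnn, le_div_iff₀ hη] at this
    linarith
  have hcast : ∀ v, Reg d M α wv v ≠ ⊤ →
      (F v : EReal) + ((ENNReal.ofReal η * Reg d M α wv v : ℝ≥0∞) : EReal) =
      ((F v + η * (Reg d M α wv v).toReal : ℝ) : EReal) := by
    intro v hv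
    rw [EReal.coe_add, ← EReal.coe_ennreal_toReal (ENNReal.mul_ne_top ENNReal.ofReal_ne_top hv),
      ENNReal.toReal_mul, ENNReal.toReal_ofReal hη.le]
  refine ⟨w, hw, fun v hv => ?_⟩
  by_cases hvt : Reg d M α wv v = ⊤
  · rw [hvt, ENNReal.mul_top (by simpa using hη)]
    simp
  · rw [hcast w hwfin, hcast v hvt, EReal.coe_le_coe_iff]
    exact hwle.trans (csInf_le hSbd ⟨v, hv, hvt, rfl⟩)
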